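/- Let H be the graph on vertices v_1, v_2, v_3, v_4 whose edges are exactly v_1v_2, v_2v_3, v_3v_4, and v_1v_3, and let L be a list assignment for H such that |L(v_1)| = |L(v_4)| = 5, |L(v_2)| = |L(v_3)| = 8, and the triangle v_1 v_2 v_3 has an (L:3)-coloring. Then H is (L:3)-colorable. -/

import Mathlib

/-- `φ` is an `(L:3)`-coloring of `G`. -/
def IsL3Coloring {V : Type*} (G : SimpleGraph V) (L : V → Finset ℕ)
    (φ : V → Finset ℕ) : Prop :=
  (∀ v, φ v ⊆ L v) ∧ (∀ v, (φ v).card = 3) ∧ ∀ ⦃u v⦄, G.Adj u v → Disjoint (φ u) (φ v)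

/-- The subgraph of `G` induced on the vertex set `s` has an `(L:3)`-coloring. -/
def HasL3ColoringOn {V : Type*} (G : SimpleGraph V) (L : V → Finset ℕ) (s : Set V) : Prop :=
  ∃ φ : V → Finset ℕ, (∀ v ∈ s, φ v ⊆ L v) ∧ (∀ v ∈ s, (φ v).card = 3) ∧
    ∀ u ∈ s, ∀ v ∈ s, G.Adj u v → Disjoint (φ u) (φ v)

/-- The graph on vertices `v₁,v₂,v₃,v₄` (as `0,1,2,3`) with edges
`v₁v₂`, `v₂v₃`, `v₃v₄`, and `v₁v₃`. -/
def lollipopGraph : SimpleGraph (Fin 4) :=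
  SimpleGraph.fromRel (fun u v =>
    (u = 0 ∧ v = 1) ∨ (u = 1 ∧ v = 2) ∨ (u = 2 ∧ v = 3) ∨ (u = 0 ∧ v = 2))

/-- A triple can be modified to contain a new color `x` and to avoid a given color `w`. -/
theorem exists_card_eq_three_insert {c : Finset ℕ} (hc : c.card = 3) (w : ℕ) {x : ℕ}
    (hx : x ∉ c) :
    ∃ c' : Finset ℕ, c'.card = 3 ∧ x ∈ c' ∧ c' ⊆ insert x (c.erase w) := by
  have h : 2 ≤ (c.erase w).card := by
    have := Finset.pred_card_le_card_erase (s := c) (a := w)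
    omega
  obtain ⟨e, he, he2⟩ := Finset.exists_subset_card_eq h
  have hxe : x ∉ e := fun h' => hx (Finset.mem_of_mem_erase (he h'))
  exact ⟨insert x e, by rw [Finset.card_insert_of_notMem hxe, he2], Finset.mem_insert_self _ _,
    Finset.insert_subset_insert _ he⟩

theorem card_insert_erase {s : Finset ℕ} {x y : ℕ} (hx : x ∈ s) (hy : y ∉ s) :
    (insert y (s.erase x)).card = s.card := by
  rw [Finset.card_insert_of_notMem fun h => hy (Finset.mem_of_mem_erase h),
    Finset.card_erase_add_one hx]

/-- A triangle with lists `A`, `B`, `C` of sizes 5, 8, 8 that has a coloring by triples has one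
whose third triple is not contained in a given set `D` of size 5. -/
theorem exists_triangle_coloring_not_subset {A B C D a b c : Finset ℕ}
    (hA : A.card = 5) (hB : B.card = 8) (hC : C.card = 8) (hD : D.card = 5)
    (ha : a ⊆ A) (hb : b ⊆ B) (hc : c ⊆ C)
    (ha3 : a.card = 3) (hb3 : b.card = 3) (hc3 : c.card = 3)
    (hab : Disjoint a b) (hbc : Disjoint b c) (hac : Disjoint a c) :
    ∃ a' b' c' : Finset ℕ, a' ⊆ A ∧ b' ⊆ B ∧ c' ⊆ C ∧ a'.card = 3 ∧ b'.card = 3 ∧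
      c'.card = 3 ∧ Disjoint a' b' ∧ Disjoint b' c' ∧ Disjoint a' c' ∧ ¬ c' ⊆ D := by
  by_cases hcD : c ⊆ D
  swap
  · exact ⟨a, b, c, ha, hb, hc, ha3, hb3, hc3, hab, hbc, hac, hcD⟩
  -- It suffices to recolor the first two vertices using one new color, freeing a color of `C \ D`.
  have key : ∀ (a' b' : Finset ℕ) (w x : ℕ), a' ⊆ A → b' ⊆ B → a'.card = 3 → b'.card = 3 →
      Disjoint a' b' → x ∈ C → x ∉ D → x ∉ a' → x ∉ b' → a' ∪ b' ⊆ insert w (a ∪ b) →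
      ∃ a' b' c' : Finset ℕ, a' ⊆ A ∧ b' ⊆ B ∧ c' ⊆ C ∧ a'.card = 3 ∧ b'.card = 3 ∧
        c'.card = 3 ∧ Disjoint a' b' ∧ Disjoint b' c' ∧ Disjoint a' c' ∧ ¬ c' ⊆ D := by
    intro a' b' w x ha' hb' ha3' hb3' hab' hxC hxD hxa hxb hw
    obtain ⟨c', hc3', hxc', hc'⟩ := exists_card_eq_three_insert hc3 w fun h => hxD (hcD h)
    refine ⟨a', b', c', ha', hb', ?_, ha3', hb3', hc3', hab', ?_, ?_, fun h => hxD (h hxc')⟩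
    · intro z hz
      grind
    · rw [Finset.disjoint_left] at *
      intro z hz hz'
      have h1 := hw (Finset.mem_union_right _ hz)
      have h2 := hc' hz'
      grind
    · rw [Finset.disjoint_left] at *
      intro z hz hz'
      have h1 := hw (Finset.mem_union_left _ hz)
      have h2 := hc' hz'
      grind
  obtain ⟨w, hw⟩ : (B \ (a ∪ b)).Nonempty := by
    rw [← Finset.card_pos]
    have := Finset.le_card_sdiff (a ∪ b) B
    have := Finset.card_union_le a b
    omega
  obtain ⟨x, hx⟩ : (C \ D).Nonempty := by
    rw [← Finset.card_pos]
    have := Finset.le_card_sdiff D C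
    omega
  obtain ⟨y, hy⟩ : (A \ a).Nonempty := by
    rw [← Finset.card_pos]
    have := Finset.le_card_sdiff a A
    omega
  simp only [Finset.mem_sdiff, Finset.mem_union, not_or] at hw hx hy
  obtain ⟨hwB, hwa, hwb⟩ := hw
  obtain ⟨hxC, hxD⟩ := hx
  obtain ⟨hyA, hya⟩ := hy
  rw [Finset.disjoint_left] at hab
  by_cases hxb : x ∈ b
  · refine key a (insert w (b.erase x)) w x ha ?_ ha3 (by rw [card_insert_erase hxb hwb, hb3]) ?_
      hxC hxD (fun h => hab h hxb) ?_ ?_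
    · grind
    · rw [Finset.disjoint_left]; grind
    · grind
    · intro z; grind
  by_cases hxa : x ∈ a
  swap
  · exact key a b x x ha hb ha3 hb3 (Finset.disjoint_left.2 hab) hxC hxD hxa hxb
      (Finset.subset_insert _ _)
  by_cases hyb : y ∈ b
  · refine key (insert y (a.erase x)) (insert w (b.erase y)) w x ?_ ?_
      (by rw [card_insert_erase hxa hya, ha3]) (by rw [card_insert_erase hyb hwb, hb3]) ?_
      hxC hxD ?_ ?_ ?_
    · grind
    · grind
    · rw [Finset.disjoint_left]; grind
    · grind
    · grind
    · intro z; grind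
  · refine key (insert y (a.erase x)) b y x ?_ hb
      (by rw [card_insert_erase hxa hya, ha3]) hb3 ?_ hxC hxD ?_ hxb ?_
    · grind
    · rw [Finset.disjoint_left]; grind
    · grind
    · intro z; grind

theorem stmt_8 (L : Fin 4 → Finset ℕ)
    (h1 : (L 0).card = 5) (h2 : (L 1).card = 8) (h3 : (L 2).card = 8) (h4 : (L 3).card = 5)
    (htri : HasL3ColoringOn lollipopGraph L {0, 1, 2}) :
    ∃ φ, IsL3Coloring lollipopGraph L φ := by
  obtain ⟨φ, hsub, hcard, hdisj⟩ := htri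
  have m0 : (0 : Fin 4) ∈ ({0, 1, 2} : Set (Fin 4)) := by simp
  have m1 : (1 : Fin 4) ∈ ({0, 1, 2} : Set (Fin 4)) := by simp
  have m2 : (2 : Fin 4) ∈ ({0, 1, 2} : Set (Fin 4)) := by simp
  obtain ⟨a, b, c, ha, hb, hc, ha3, hb3, hc3, hab, hbc, hac, hcD⟩ :=
    exists_triangle_coloring_not_subset h1 h2 h3 h4 (hsub 0 m0) (hsub 1 m1) (hsub 2 m2)
      (hcard 0 m0) (hcard 1 m1) (hcard 2 m2)
      (hdisj 0 m0 1 m1 (by simp [lollipopGraph])) (hdisj 1 m1 2 m2 (by simp [lollipopGraph]))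
      (hdisj 0 m0 2 m2 (by simp [lollipopGraph]))
  have hlt : (c ∩ L 3).card < c.card :=
    Finset.card_lt_card (Finset.inter_subset_left.ssubset_of_ne
      fun h => hcD (Finset.inter_eq_left.1 h))
  have hle : 3 ≤ (L 3 \ c).card := by
    rw [Finset.card_sdiff]
    omega
  obtain ⟨d, hd, hd3⟩ := Finset.exists_subset_card_eq hle
  have hcd : Disjoint c d := Finset.disjoint_sdiff.mono_right hd
  refine ⟨![a, b, c, d], ?_, ?_, ?_⟩
  · intro v
    fin_cases v
    exacts [ha, hb, hc, hd.trans Finset.sdiff_subset]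
  · intro v
    fin_cases v
    exacts [ha3, hb3, hc3, hd3]
  · intro u v huv
    fin_cases u <;> fin_cases v <;>
      first
      | exact hab
      | exact hbc
      | exact hac
      | exact hcd
      | exact hab.symm
      | exact hbc.symm
      | exact hac.symm
      | exact hcd.symm
      | exact absurd huv (by simp [lollipopGraph])
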